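/- arXiv:2603.15148 — 5 statements merged into one kernel-verified Lean document; each statement's English description precedes it below -/
import Mathlib

section
/- Let F be a field with char(F) ≠ 2 and char(F) ≠ 3. Every two-dimensional algebra over F with nonzero multiplication is isomorphic to an algebra given by one of the following matrices of structure constants: A1(α1,α2,α4,β1) = (α1, α2, 1+α2, α4; β1, −α1, 1−α1, −α2) with (α1,α2,α4,β1) ∈ F^4; A2(α1,α4,β2) = (α1, 0, 0, α4; 1, β2, 1−α1, 0) with α4 ≠ 0; A3(α1,α4,β2) = (α1, 0, 0, α4; 0, β2, 1−α1, 0); A4(β1,β2) = (0, 1, 1, 0; β1, β2, 1, −1); A5(α1) = (α1, 0, 0, 0; 1, 2α1−1, 1−α1, 0); A6(α1,α4) = (α1, 0, 0, α4; 1, 1−α1, −α1, 0) with α4 ≠ 0; A7(α1,α4) = (α1, 0, 0, α4; 0, 1−α1, −α1, 0); A8(β1) = (0, 1, 1, 0; β1, 1, 0, −1); A9 = (1/3, 0, 0, 0; 1, 2/3, −1/3, 0); A10(β1) = (0, 1, 1, 1; β1, 0, 0, −1) where the polynomial (β1·t^3−3t−1)(β1·t^2+β1·t+1)(β1^2·t^3+6β1·t^2+3β1·t+β1−2)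 has no root in F; A11(β1) = (0, 0, 0, 1; β1, 0, 0, 0) with β1 ∈ F; A12(β1) = (0, 1, 1, 0; β1, 0, 0, −1) with β1 ∈ F. -/
/-- The bilinear multiplication on `F²` determined by a 2×4 matrix of structure
constants `M = (α₁ α₂ α₃ α₄; β₁ β₂ β₃ β₄)`, i.e. `e₁e₁ = α₁e₁+β₁e₂`,
`e₁e₂ = α₂e₁+β₂e₂`, `e₂e₁ = α₃e₁+β₃e₂`, `e₂e₂ = α₄e₁+β₄e₂`. -/
def scMul (F : Type*) [Field F] (M : Matrix (Fin 2) (Fin 4) F)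
    (x y : Fin 2 → F) : Fin 2 → F :=
  fun i => x 0 * y 0 * M i 0 + x 0 * y 1 * M i 1 + x 1 * y 0 * M i 2 + x 1 * y 1 * M i 3

/-- Two algebras given by matrices of structure constants are isomorphic iff there is
an `F`-linear bijection `g` with `g (x·y) = g x · g y`. -/
def scIso (F : Type*) [Field F] (M N : Matrix (Fin 2) (Fin 4) F) : Prop :=
  ∃ g : (Fin 2 → F) ≃ₗ[F] (Fin 2 → F), ∀ x y, g (scMul F M x y) = scMul F N (g x) (g y)

theorem scIso.refl {F : Type*} [Field F] (M : Matrix (Fin 2) (Fin 4) F) : scIso F M M :=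
  ⟨LinearEquiv.refl F _, fun _ _ => rfl⟩

theorem scIso.trans {F : Type*} [Field F] {M N K : Matrix (Fin 2) (Fin 4) F}
    (h : scIso F M N) (h' : scIso F N K) : scIso F M K := by
  obtain ⟨g, hg⟩ := h
  obtain ⟨g', hg'⟩ := h'
  exact ⟨g.trans g', fun x y => by simp [hg, hg']⟩

/-- Change of basis: `c₁, …, d₄` are the structure constants with respect to the basis
`p e₁ + q e₂`, `r e₁ + s e₂`. -/
theorem scIso_of_basis {F : Type*} [Field F]
    {a1 a2 a3 a4 b1 b2 b3 b4 c1 c2 c3 c4 d1 d2 d3 d4 : F} (p q r s : F)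
    (hdet : p * s - q * r ≠ 0)
    (h1 : p ^ 2 * a1 + p * q * (a2 + a3) + q ^ 2 * a4 = c1 * p + d1 * r)
    (h1' : p ^ 2 * b1 + p * q * (b2 + b3) + q ^ 2 * b4 = c1 * q + d1 * s)
    (h2 : p * r * a1 + p * s * a2 + q * r * a3 + q * s * a4 = c2 * p + d2 * r)
    (h2' : p * r * b1 + p * s * b2 + q * r * b3 + q * s * b4 = c2 * q + d2 * s)
    (h3 : p * r * a1 + q * r * a2 + p * s * a3 + q * s * a4 = c3 * p + d3 * r)
    (h3' : p * r * b1 + q * r * b2 + p * s * b3 + q * s * b4 = c3 * q + d3 * s)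
    (h4 : r ^ 2 * a1 + r * s * (a2 + a3) + s ^ 2 * a4 = c4 * p + d4 * r)
    (h4' : r ^ 2 * b1 + r * s * (b2 + b3) + s ^ 2 * b4 = c4 * q + d4 * s) :
    scIso F !![a1, a2, a3, a4; b1, b2, b3, b4] !![c1, c2, c3, c4; d1, d2, d3, d4] := by
  let P : Matrix (Fin 2) (Fin 2) F := !![p, r; q, s]
  have hP : IsUnit P.det := by
    rw [Matrix.det_fin_two_of, isUnit_iff_ne_zero]
    contrapose! hdet
    linear_combination hdet
  let h : (Fin 2 → F) ≃ₗ[F] (Fin 2 → F) := P.toLinearEquiv' (P.invertibleOfIsUnitDet hP)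
  have hh : ∀ x, h x = ![p * x 0 + r * x 1, q * x 0 + s * x 1] := by
    intro x
    change P.mulVec x = _
    ext i
    fin_cases i <;> simp [P, Matrix.mulVec, dotProduct, Fin.sum_univ_two]
  refine ⟨h.symm, fun x y => ?_⟩
  obtain ⟨x, rfl⟩ := h.surjective x
  obtain ⟨y, rfl⟩ := h.surjective y
  rw [LinearEquiv.symm_apply_eq]
  simp only [LinearEquiv.symm_apply_apply]
  rw [hh x, hh y, hh]
  ext i
  fin_cases i <;> simp [scMul]
  · linear_combination x 0 * y 0 * h1 + x 0 * y 1 * h2 + x 1 * y 0 * h3 + x 1 * y 1 * h4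
  · linear_combination x 0 * y 0 * h1' + x 0 * y 1 * h2' + x 1 * y 0 * h3' + x 1 * y 1 * h4'

/-- Any nondegenerate change of basis is realized, and transforms the traces of the left and
right multiplications as linear forms. -/
theorem exists_scIso_of_basis {F : Type*} [Field F] (a1 a2 a3 a4 b1 b2 b3 b4 p q r s : F)
    (hdet : p * s - q * r ≠ 0) :
    ∃ c1 c2 c3 c4 d1 d2 d3 d4 : F,
      scIso F !![a1, a2, a3, a4; b1, b2, b3, b4] !![c1, c2, c3, c4; d1, d2, d3, d4] ∧
      c1 + d2 = p * (a1 + b2) + q * (a3 + b4) ∧ c3 + d4 = r * (a1 + b2) + s * (a3 + b4) ∧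
      c1 + d3 = p * (a1 + b3) + q * (a2 + b4) ∧ c2 + d4 = r * (a1 + b3) + s * (a2 + b4) := by
  obtain ⟨e, he⟩ : ∃ e, e * (p * s - q * r) = 1 := ⟨_, inv_mul_cancel₀ hdet⟩
  have cramer : ∀ x y : F, ∃ c d : F, c = e * (s * x - r * y) ∧ d = e * (p * y - q * x) ∧
      x = c * p + d * r ∧ y = c * q + d * s := by
    intro x y
    refine ⟨_, _, rfl, rfl, ?_, ?_⟩
    · linear_combination -x * he
    · linear_combination -y * he
  obtain ⟨c1, d1, hc1, hd1, h1, h1'⟩ := cramer (p ^ 2 * a1 + p * q * (a2 + a3) + q ^ 2 * a4)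
    (p ^ 2 * b1 + p * q * (b2 + b3) + q ^ 2 * b4)
  obtain ⟨c2, d2, hc2, hd2, h2, h2'⟩ := cramer
    (p * r * a1 + p * s * a2 + q * r * a3 + q * s * a4)
    (p * r * b1 + p * s * b2 + q * r * b3 + q * s * b4)
  obtain ⟨c3, d3, hc3, hd3, h3, h3'⟩ := cramer
    (p * r * a1 + q * r * a2 + p * s * a3 + q * s * a4)
    (p * r * b1 + q * r * b2 + p * s * b3 + q * s * b4)
  obtain ⟨c4, d4, hc4, hd4, h4, h4'⟩ := cramer (r ^ 2 * a1 + r * s * (a2 + a3) + s ^ 2 * a4)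
    (r ^ 2 * b1 + r * s * (b2 + b3) + s ^ 2 * b4)
  refine ⟨c1, c2, c3, c4, d1, d2, d3, d4,
    scIso_of_basis p q r s hdet h1 h1' h2 h2' h3 h3' h4 h4', ?_, ?_, ?_, ?_⟩
  · linear_combination hc1 + hd2 + (p * (a1 + b2) + q * (a3 + b4)) * he
  · linear_combination hc3 + hd4 + (r * (a1 + b2) + s * (a3 + b4)) * he
  · linear_combination hc1 + hd3 + (p * (a1 + b3) + q * (a2 + b4)) * he
  · linear_combination hc2 + hd4 + (r * (a1 + b3) + s * (a2 + b4)) * he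

/-- If both trace forms vanish on `e₂` and `e₂e₂` has no `e₂`-component, then the
`e₂`-component of `e₁e₁` can be scaled to `0` or `1`. -/
theorem exists_scIso_scale {F : Type*} [Field F] (a1 a4 b1 b2 b3 : F) :
    ∃ c4 d1 : F, scIso F !![a1, 0, 0, a4; b1, b2, b3, 0] !![a1, 0, 0, c4; d1, b2, b3, 0] ∧
      (d1 = 0 ∨ d1 = 1 ∧ (a4 ≠ 0 → c4 ≠ 0)) := by
  by_cases hb : b1 = 0
  · exact ⟨a4, b1, scIso.refl _, .inl hb⟩
  · refine ⟨b1 ^ 2 * a4, 1, scIso_of_basis 1 0 0 b1 ?_ ?_ ?_ ?_ ?_ ?_ ?_ ?_ ?_,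
      .inr ⟨rfl, fun h => mul_ne_zero (pow_ne_zero 2 hb) h⟩⟩
    · simpa using hb
    all_goals ring

/-- Normal forms of the algebras whose two trace forms both vanish on `e₂`. -/
theorem exists_scIso_of_trace_eq_zero {F : Type*} [Field F] (two : (2 : F) ≠ 0)
    (a1 a2 a4 b1 b2 b3 : F) :
    ∃ c1 c2 c4 d1 d2 d3 : F,
      scIso F !![a1, a2, a2, a4; b1, b2, b3, -a2] !![c1, c2, c2, c4; d1, d2, d3, -c2] ∧
      c1 + d2 = a1 + b2 ∧ c1 + d3 = a1 + b3 ∧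
      (c2 = 0 ∧ d1 = 0 ∨ c2 = 0 ∧ d1 = 1 ∧ c4 ≠ 0 ∨
        c2 = 0 ∧ d1 = 1 ∧ c4 = 0 ∧ d2 + d3 = c1 ∨ c1 = 0 ∧ c2 = 1 ∧ c4 = 0) := by
  by_cases h4 : a4 = 0
  · subst h4
    by_cases h2 : a2 = 0
    · subst h2
      by_cases h : b2 + b3 = a1
      · by_cases hb : b1 = 0
        · exact ⟨a1, 0, 0, b1, b2, b3, scIso.refl _, rfl, rfl, .inl ⟨rfl, hb⟩⟩
        · refine ⟨a1, 0, 0, 1, b2, b3, scIso_of_basis 1 0 0 b1 ?_ ?_ ?_ ?_ ?_ ?_ ?_ ?_ ?_,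
            rfl, rfl, .inr (.inr (.inl ⟨rfl, rfl, rfl, h⟩))⟩
          · simpa using hb
          all_goals ring
      · have h' : b2 + b3 - a1 ≠ 0 := sub_ne_zero.2 h
        refine ⟨a1, 0, 0, 0, b2, b3,
          scIso_of_basis 1 (-b1 / (b2 + b3 - a1)) 0 1 ?_ ?_ ?_ ?_ ?_ ?_ ?_ ?_ ?_,
          rfl, rfl, .inl ⟨rfl, rfl⟩⟩
        · simp
        all_goals field_simp
        all_goals ring
    · have h22 : 2 * a2 ≠ 0 := mul_ne_zero two h2
      obtain ⟨d, rfl⟩ : ∃ d, a1 = -2 * d * a2 := ⟨-a1 / (2 * a2), by field_simp⟩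
      refine ⟨0, 1, 0, a2 * (b1 + d * (b2 + b3) - d ^ 2 * a2), b2 - 2 * d * a2,
        b3 - 2 * d * a2, scIso_of_basis 1 d 0 a2⁻¹ ?_ ?_ ?_ ?_ ?_ ?_ ?_ ?_ ?_, by ring, by ring,
        .inr (.inr (.inr ⟨rfl, rfl, rfl⟩))⟩
      · simpa using h2
      all_goals first | ring1 | (field_simp; done) | (field_simp; ring1)
  · obtain ⟨d, rfl⟩ : ∃ d, a2 = -d * a4 := ⟨-a2 / a4, by field_simp⟩
    obtain ⟨c4, d1, hscale, h⟩ := exists_scIso_scale (a1 - d ^ 2 * a4) a4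
      (b1 + d * (b2 + b3) + 2 * d ^ 3 * a4 - d * a1) (b2 + d ^ 2 * a4) (b3 + d ^ 2 * a4)
    have hshear : scIso F !![a1, -d * a4, -d * a4, a4; b1, b2, b3, -(-d * a4)]
        !![a1 - d ^ 2 * a4, 0, 0, a4; b1 + d * (b2 + b3) + 2 * d ^ 3 * a4 - d * a1,
          b2 + d ^ 2 * a4, b3 + d ^ 2 * a4, 0] := by
      refine scIso_of_basis 1 d 0 1 ?_ ?_ ?_ ?_ ?_ ?_ ?_ ?_ ?_
      · simp
      all_goals ring
    refine ⟨_, 0, c4, d1, _, _, by rw [neg_zero]; exact hshear.trans hscale, by ring, by ring, ?_⟩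
    tauto

/-- The algebras `A₁₁(β₁)` and `A₁₂(β₁)` of the classification. -/
def IsA11OrA12 {F : Type*} [Field F] (N : Matrix (Fin 2) (Fin 4) F) : Prop :=
  (∃ b1 : F, N = !![0, 0, 0, 1; b1, 0, 0, 0]) ∨ ∃ b1 : F, N = !![0, 1, 1, 0; b1, 0, 0, -1]

theorem exists_scIso_antidiagonal {F : Type*} [Field F] (a4 b1 : F) (h : a4 ≠ 0 ∨ b1 ≠ 0) :
    ∃ N, scIso F !![0, 0, 0, a4; b1, 0, 0, 0] N ∧ IsA11OrA12 N := by
  by_cases h4 : a4 = 0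
  · have hb : b1 ≠ 0 := h.resolve_left (not_not.2 h4)
    refine ⟨_, scIso_of_basis 0 b1 1 0 ?_ ?_ ?_ ?_ ?_ ?_ ?_ ?_ ?_, .inl ⟨0, rfl⟩⟩
    · simpa using hb
    all_goals simp [h4]
  · refine ⟨_, scIso_of_basis a4 0 0 1 ?_ ?_ ?_ ?_ ?_ ?_ ?_ ?_ ?_, .inl ⟨a4 ^ 2 * b1, rfl⟩⟩
    · simpa using h4
    all_goals ring

/-- Trace-free algebras in which `e₂` spans a subalgebra. -/
theorem exists_scIso_of_subalgebra {F : Type*} [Field F] (two : (2 : F) ≠ 0)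
    (three : (3 : F) ≠ 0) (a1 a2 b1 : F) (h : a1 ≠ 0 ∨ a2 ≠ 0 ∨ b1 ≠ 0) :
    ∃ N, scIso F !![a1, a2, a2, 0; b1, -a1, -a1, -a2] N ∧ IsA11OrA12 N := by
  by_cases h2 : a2 = 0
  · subst h2
    by_cases h1 : a1 = 0
    · subst h1
      simpa using exists_scIso_antidiagonal 0 b1 (by simpa using h)
    · refine ⟨_, scIso_of_basis 0 1 (-1 / a1) (-b1 / (3 * a1 ^ 2)) ?_ ?_ ?_ ?_ ?_ ?_ ?_ ?_ ?_,
        .inr ⟨0, rfl⟩⟩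
      · simp [h1]
      all_goals first | ring1 | (field_simp; done) | (field_simp; ring1)
  · obtain ⟨d, rfl⟩ : ∃ d, a1 = -2 * d * a2 := ⟨-a1 / (2 * a2), by field_simp⟩
    refine ⟨_, scIso_of_basis 1 d 0 a2⁻¹ ?_ ?_ ?_ ?_ ?_ ?_ ?_ ?_ ?_,
      .inr ⟨a2 * (b1 + 3 * d ^ 2 * a2), rfl⟩⟩
    · simpa using h2
    all_goals field_simp
    all_goals ring

/-- The algebra `A₁₀(b)` either satisfies the root-freeness condition or is isomorphic to some
`A₁₁` or `A₁₂`. The factors of the polynomial are, dehomogenized, the cubic form `x ∧ x²`, its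
Hessian, and the Jacobian of the two. -/
theorem A10_dichotomy {F : Type*} [Field F] (two : (2 : F) ≠ 0) (three : (3 : F) ≠ 0) (b : F) :
    (∀ t : F, (b * t ^ 3 - 3 * t - 1) * (b * t ^ 2 + b * t + 1) *
      (b ^ 2 * t ^ 3 + 6 * b * t ^ 2 + 3 * b * t + b - 2) ≠ 0) ∨
    ∃ N, scIso F !![0, 1, 1, 1; b, 0, 0, -1] N ∧ IsA11OrA12 N := by
  by_cases hroot : ∃ t, b * t ^ 3 - 3 * t - 1 = 0
  · right
    obtain ⟨t, ht⟩ := hroot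
    obtain ⟨N, hN, h⟩ := exists_scIso_of_subalgebra two three (-(b * t)) (1 - b * t ^ 2) b (by
      by_contra! h0
      simp [h0.2.2] at h0)
    refine ⟨N, .trans (scIso_of_basis 1 0 t 1 ?_ ?_ ?_ ?_ ?_ ?_ ?_ ?_ ?_) hN, h⟩
    · simp
    all_goals first | ring1 | linear_combination -ht
  · push Not at hroot
    have hb : b ≠ 0 := by
      rintro rfl
      exact hroot (-1 / 3) (by field_simp; ring)
    have hb4 : b ≠ 4 := by
      rintro rfl
      exact hroot 1 (by ring)
    by_cases hhess : ∃ t, b * t ^ 2 + b * t + 1 = 0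
    · right
      obtain ⟨t, ht⟩ := hhess
      have hdet : 2 * t + 1 ≠ 0 := by
        intro h
        exact hb4 (by linear_combination -4 * ht + b * (2 * t + 1) * h)
      obtain ⟨N, hN, h⟩ := exists_scIso_antidiagonal (b * (1 + t) ^ 2 - 1) (b * t ^ 2 - 1) (by
        by_contra! h0
        have h1 : b * (2 * t + 1) = 0 := by linear_combination h0.1 - h0.2
        exact (mul_ne_zero hb hdet) h1)
      refine ⟨N, .trans (scIso_of_basis t 1 (-1 - t) 1 ?_ ?_ ?_ ?_ ?_ ?_ ?_ ?_ ?_) hN, h⟩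
      · contrapose! hdet
        linear_combination hdet
      all_goals grind
    · left
      push Not at hhess
      intro t
      refine mul_ne_zero (mul_ne_zero (hroot t) (hhess t)) fun ht => ?_
      by_cases hy : 2 * t + 1 = 0
      · refine hb4 ?_
        have : (b - 4) ^ 2 = 0 := by grind
        exact sub_eq_zero.1 (pow_eq_zero_iff two_ne_zero |>.1 this)
      · have hy' : b * (2 * t + 1) ≠ 0 := mul_ne_zero hb hy
        obtain ⟨z, hz⟩ : ∃ z, z * (b * (2 * t + 1)) = -(b * t + 2) :=
          ⟨_, div_mul_cancel₀ _ hy'⟩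
        refine hroot z ((mul_eq_zero_iff_left (pow_ne_zero 3 hy')).1 ?_)
        linear_combination (b * ((z * (b * (2 * t + 1))) ^ 2 - z * (b * (2 * t + 1)) * (b * t + 2)
          + (b * t + 2) ^ 2) - 3 * (b * (2 * t + 1)) ^ 2) * hz + (4 - b) * b * ht

/-- Normal forms of the nonzero algebras with vanishing trace forms. -/
theorem exists_scIso_of_traceFree {F : Type*} [Field F] (two : (2 : F) ≠ 0)
    (three : (3 : F) ≠ 0) (a1 a2 a4 b1 : F) (h : a1 ≠ 0 ∨ a2 ≠ 0 ∨ a4 ≠ 0 ∨ b1 ≠ 0) :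
    ∃ N, scIso F !![a1, a2, a2, a4; b1, -a1, -a1, -a2] N ∧
      ((∃ b : F, (∀ t : F, (b * t ^ 3 - 3 * t - 1) * (b * t ^ 2 + b * t + 1) *
          (b ^ 2 * t ^ 3 + 6 * b * t ^ 2 + 3 * b * t + b - 2) ≠ 0) ∧
        N = !![0, 1, 1, 1; b, 0, 0, -1]) ∨ IsA11OrA12 N) := by
  by_cases h4 : a4 = 0
  · subst h4
    obtain ⟨N, hN, hN'⟩ := exists_scIso_of_subalgebra two three a1 a2 b1 (by simpa using h)
    exact ⟨N, hN, .inr hN'⟩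
  by_cases hb : b1 = 0
  · subst hb
    obtain ⟨N, hN, hN'⟩ := exists_scIso_of_subalgebra two three (-a2) (-a1) a4 (by tauto)
    refine ⟨N, .trans (scIso_of_basis 0 1 1 0 ?_ ?_ ?_ ?_ ?_ ?_ ?_ ?_ ?_) hN, .inr hN'⟩
    · simp
    all_goals ring
  obtain ⟨d, rfl⟩ : ∃ d, a1 = d * b1 := ⟨a1 / b1, by field_simp⟩
  have hdepress : scIso F !![d * b1, a2, a2, a4; b1, -(d * b1), -(d * b1), -a2]
      !![0, a2 + d ^ 2 * b1, a2 + d ^ 2 * b1, a4 + 2 * d ^ 3 * b1 + 3 * d * a2;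
        b1, 0, 0, -(a2 + d ^ 2 * b1)] := by
    refine scIso_of_basis 1 0 d 1 ?_ ?_ ?_ ?_ ?_ ?_ ?_ ?_ ?_
    · simp
    all_goals ring
  generalize a2 + d ^ 2 * b1 = A, a4 + 2 * d ^ 3 * b1 + 3 * d * a2 = B at hdepress
  by_cases hA : A = 0
  · subst hA
    obtain ⟨N, hN, hN'⟩ := exists_scIso_antidiagonal B b1 (.inr hb)
    exact ⟨N, hdepress.trans (by simpa using hN), .inr hN'⟩
  by_cases hB : B = 0
  · subst hB
    obtain ⟨N, hN, hN'⟩ := exists_scIso_of_subalgebra two three 0 A b1 (.inr (.inr hb))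
    exact ⟨N, hdepress.trans (by simpa using hN), .inr hN'⟩
  have hscale : scIso F !![0, A, A, B; b1, 0, 0, -A]
      !![0, 1, 1, 1; B ^ 2 * b1 / A ^ 3, 0, 0, -1] := by
    refine scIso_of_basis (B / A ^ 2) 0 0 A⁻¹ ?_ ?_ ?_ ?_ ?_ ?_ ?_ ?_ ?_
    · simp [hA, hB]
    all_goals field_simp
    all_goals ring
  rcases A10_dichotomy two three (B ^ 2 * b1 / A ^ 3) with h10 | ⟨N, hN, hN'⟩
  · exact ⟨_, hdepress.trans hscale, .inl ⟨_, h10, rfl⟩⟩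
  · exact ⟨N, (hdepress.trans hscale).trans hN, .inr hN'⟩

/-- Two linear forms on `F²` that are linearly dependent have a common kernel vector, which can
be completed to a basis; on the complement they can be normalized. -/
theorem exists_basis_of_dependent {F : Type*} [Field F] (l1 l2 r1 r2 : F)
    (h : r1 * l2 - r2 * l1 = 0) :
    ∃ p q r s : F, p * s - q * r ≠ 0 ∧ r * l1 + s * l2 = 0 ∧ r * r1 + s * r2 = 0 ∧
      (p * r1 + q * r2 = 1 ∨ p * r1 + q * r2 = 0 ∧ p * l1 + q * l2 = 1 ∨
        p * r1 + q * r2 = 0 ∧ p * l1 + q * l2 = 0) := by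
  have key : ∀ x y : F, x ≠ 0 ∨ y ≠ 0 → ∃ p q : F, p * x + q * y = 1 := by
    rintro x y (hx | hy)
    · exact ⟨x⁻¹, 0, by field_simp; ring⟩
    · exact ⟨0, y⁻¹, by field_simp; ring⟩
  by_cases hr : r1 ≠ 0 ∨ r2 ≠ 0
  · obtain ⟨p, q, hpq⟩ := key r1 r2 hr
    refine ⟨p, q, -r2, r1, ?_, by linear_combination h, by ring, .inl hpq⟩
    exact fun h0 => one_ne_zero (by linear_combination h0 - hpq : (1 : F) = 0)
  · obtain ⟨rfl, rfl⟩ : r1 = 0 ∧ r2 = 0 := by simpa using hr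
    by_cases hl : l1 ≠ 0 ∨ l2 ≠ 0
    · obtain ⟨p, q, hpq⟩ := key l1 l2 hl
      refine ⟨p, q, -l2, l1, ?_, by ring, by ring, .inr (.inl ⟨by ring, hpq⟩)⟩
      exact fun h0 => one_ne_zero (by linear_combination h0 - hpq : (1 : F) = 0)
    · obtain ⟨rfl, rfl⟩ : l1 = 0 ∧ l2 = 0 := by simpa using hl
      exact ⟨1, 0, 0, 1, by simp⟩

theorem eq_zero_of_scIso_zero {F : Type*} [Field F] {M : Matrix (Fin 2) (Fin 4) F}
    (h : scIso F M 0) (x y : Fin 2 → F) : scMul F M x y = 0 := by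
  obtain ⟨g, hg⟩ := h
  have h0 : g (scMul F M x y) = 0 := by
    rw [hg]
    ext i
    simp [scMul]
  simpa using h0

/-- Every bilinear multiplication on `F²` is given by its matrix of structure constants. -/
theorem exists_eq_scMul {F : Type*} [Field F]
    (μ : (Fin 2 → F) →ₗ[F] (Fin 2 → F) →ₗ[F] (Fin 2 → F)) :
    ∃ a1 a2 a3 a4 b1 b2 b3 b4 : F,
      ∀ x y, μ x y = scMul F !![a1, a2, a3, a4; b1, b2, b3, b4] x y := by
  refine ⟨μ ![1, 0] ![1, 0] 0, μ ![1, 0] ![0, 1] 0, μ ![0, 1] ![1, 0] 0, μ ![0, 1] ![0, 1] 0,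
    μ ![1, 0] ![1, 0] 1, μ ![1, 0] ![0, 1] 1, μ ![0, 1] ![1, 0] 1, μ ![0, 1] ![0, 1] 1,
    fun x y => ?_⟩
  have key : ∀ z : Fin 2 → F, z = z 0 • ![1, 0] + z 1 • ![0, 1] := by
    intro z
    ext i
    fin_cases i <;> simp
  conv_lhs => rw [key x, key y]
  ext i
  fin_cases i <;>
  · simp [scMul, -Matrix.smul_cons]
    ring

/-- Classification of nontrivial two-dimensional algebras over a field of
characteristic ≠ 2, 3. -/
theorem classification_two_dim_algebras (F : Type*) [Field F]
    (h2 : ringChar F ≠ 2) (h3 : ringChar F ≠ 3)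
    (μ : (Fin 2 → F) →ₗ[F] (Fin 2 → F) →ₗ[F] (Fin 2 → F)) (hμ : μ ≠ 0) :
    ∃ M : Matrix (Fin 2) (Fin 4) F,
      (∃ g : (Fin 2 → F) ≃ₗ[F] (Fin 2 → F), ∀ x y, g (μ x y) = scMul F M (g x) (g y)) ∧
      ((∃ a1 a2 a4 b1 : F, M = !![a1, a2, 1 + a2, a4; b1, -a1, 1 - a1, -a2]) ∨
       (∃ a1 a4 b2 : F, a4 ≠ 0 ∧ M = !![a1, 0, 0, a4; 1, b2, 1 - a1, 0]) ∨
       (∃ a1 a4 b2 : F, M = !![a1, 0, 0, a4; 0, b2, 1 - a1, 0]) ∨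
       (∃ b1 b2 : F, M = !![0, 1, 1, 0; b1, b2, 1, -1]) ∨
       (∃ a1 : F, M = !![a1, 0, 0, 0; 1, 2 * a1 - 1, 1 - a1, 0]) ∨
       (∃ a1 a4 : F, a4 ≠ 0 ∧ M = !![a1, 0, 0, a4; 1, 1 - a1, -a1, 0]) ∨
       (∃ a1 a4 : F, M = !![a1, 0, 0, a4; 0, 1 - a1, -a1, 0]) ∨
       (∃ b1 : F, M = !![0, 1, 1, 0; b1, 1, 0, -1]) ∨
       (M = !![(1 : F) / 3, 0, 0, 0; 1, 2 / 3, -(1 / 3), 0]) ∨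
       (∃ b1 : F,
          (∀ t : F, (b1 * t ^ 3 - 3 * t - 1) * (b1 * t ^ 2 + b1 * t + 1) *
            (b1 ^ 2 * t ^ 3 + 6 * b1 * t ^ 2 + 3 * b1 * t + b1 - 2) ≠ 0) ∧
          M = !![0, 1, 1, 1; b1, 0, 0, -1]) ∨
       (∃ b1 : F, M = !![0, 0, 0, 1; b1, 0, 0, 0]) ∨
       (∃ b1 : F, M = !![0, 1, 1, 0; b1, 0, 0, -1])) := by
  have two : (2 : F) ≠ 0 := Ring.two_ne_zero h2
  have three : (3 : F) ≠ 0 := fun h =>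
    h3 (CharP.ringChar_of_prime_eq_zero Nat.prime_three (by exact_mod_cast h))
  obtain ⟨a1, a2, a3, a4, b1, b2, b3, b4, hM⟩ := exists_eq_scMul μ
  have lift : ∀ N, scIso F !![a1, a2, a3, a4; b1, b2, b3, b4] N →
      ∃ g : (Fin 2 → F) ≃ₗ[F] (Fin 2 → F), ∀ x y, g (μ x y) = scMul F N (g x) (g y) := by
    rintro N ⟨g, hg⟩
    exact ⟨g, fun x y => by rw [hM, hg]⟩
  have hne : ¬ scIso F !![a1, a2, a3, a4; b1, b2, b3, b4] 0 := fun h =>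
    hμ (LinearMap.ext₂ fun x y => by simp [hM, eq_zero_of_scIso_zero h])
  by_cases hD : (a1 + b3) * (a3 + b4) - (a2 + b4) * (a1 + b2) = 0
  · obtain ⟨p, q, r, s, hdet, hl, hr, hcases⟩ :=
      exists_basis_of_dependent (a1 + b2) (a3 + b4) (a1 + b3) (a2 + b4) hD
    obtain ⟨c1, c2, c3, c4, d1, d2, d3, d4, hiso, hl1, hl2, hr1, hr2⟩ :=
      exists_scIso_of_basis a1 a2 a3 a4 b1 b2 b3 b4 p q r s hdet
    rw [hl] at hl2
    rw [hr] at hr2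
    obtain rfl : d4 = -c2 := by linear_combination hr2
    obtain rfl : c3 = c2 := by linear_combination hl2
    rw [← hl1, ← hr1] at hcases
    by_cases htf : c1 + d3 = 0 ∧ c1 + d2 = 0
    · obtain rfl : d3 = -c1 := by linear_combination htf.1
      obtain rfl : d2 = -c1 := by linear_combination htf.2
      obtain ⟨N, hN, hN'⟩ := exists_scIso_of_traceFree two three c1 c3 c4 d1 (by
        by_contra! h
        obtain ⟨rfl, rfl, rfl, rfl⟩ := h
        refine hne ?_
        convert hiso using 1
        ext i j
        fin_cases i <;> fin_cases j <;> simp)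
      refine ⟨N, lift N (hiso.trans hN), ?_⟩
      iterate 9 right
      exact hN'
    · obtain ⟨e1, e2, e4, f1, f2, f3, hiso', hl', hr', hform⟩ :=
        exists_scIso_of_trace_eq_zero two c1 c3 c4 d1 d2 d3
      refine ⟨_, lift _ (hiso.trans hiso'), ?_⟩
      rw [← hl', ← hr'] at hcases htf
      rcases hcases with h | ⟨h, h'⟩ | h
      · obtain rfl : f3 = 1 - e1 := by linear_combination h
        rcases hform with ⟨rfl, rfl⟩ | ⟨rfl, rfl, h4⟩ | ⟨rfl, rfl, rfl, h4⟩ | ⟨rfl, rfl, rfl⟩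
        · exact .inr (.inr (.inl ⟨e1, e4, f2, by simp⟩))
        · exact .inr (.inl ⟨e1, e4, f2, h4, by simp⟩)
        · obtain rfl : f2 = 2 * e1 - 1 := by linear_combination h4
          exact .inr (.inr (.inr (.inr (.inl ⟨e1, by simp⟩))))
        · exact .inr (.inr (.inr (.inl ⟨f1, f2, by simp⟩)))
      · obtain rfl : f3 = -e1 := by linear_combination h
        obtain rfl : f2 = 1 - e1 := by linear_combination h'
        rcases hform with ⟨rfl, rfl⟩ | ⟨rfl, rfl, h4⟩ | ⟨rfl, rfl, rfl, h4⟩ | ⟨rfl, rfl, rfl⟩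
        · exact .inr (.inr (.inr (.inr (.inr (.inr (.inl ⟨e1, e4, by simp⟩))))))
        · exact .inr (.inr (.inr (.inr (.inr (.inl ⟨e1, e4, h4, by simp⟩)))))
        · obtain rfl : e1 = 1 / 3 := by
            field_simp
            linear_combination -h4
          refine .inr (.inr (.inr (.inr (.inr (.inr (.inr (.inr (.inl ?_))))))))
          have : (1 : F) - 1 / 3 = 2 / 3 := by field_simp; ring
          rw [this, neg_zero]
        · exact .inr (.inr (.inr (.inr (.inr (.inr (.inr (.inl ⟨f1, by simp⟩)))))))
      · exact absurd h htf
  · set D := (a1 + b3) * (a3 + b4) - (a2 + b4) * (a1 + b2) with hDdef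
    obtain ⟨c1, c2, c3, c4, d1, d2, d3, d4, hiso, hl1, hl2, hr1, hr2⟩ :=
      exists_scIso_of_basis a1 a2 a3 a4 b1 b2 b3 b4
        ((a3 + b4) / D) (-(a1 + b2) / D) (-(a2 + b4) / D) ((a1 + b3) / D) (by
          have : (a3 + b4) / D * ((a1 + b3) / D) - -(a1 + b2) / D * (-(a2 + b4) / D) = 1 / D := by
            field_simp
            rw [hDdef]
            ring
          rw [this]
          exact one_div_ne_zero hD)
    have e1 : c1 + d2 = 0 := by rw [hl1]; field_simp; ring
    have e2 : c3 + d4 = 1 := by rw [hl2]; field_simp; rw [hDdef]; ring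
    have e3 : c1 + d3 = 1 := by rw [hr1]; field_simp; rw [hDdef]; ring
    have e4 : c2 + d4 = 0 := by rw [hr2]; field_simp; ring
    obtain rfl : d2 = -c1 := by linear_combination e1
    obtain rfl : d4 = -c2 := by linear_combination e4
    obtain rfl : d3 = 1 - c1 := by linear_combination e3
    obtain rfl : c3 = 1 + c2 := by linear_combination e2
    exact ⟨_, lift _ hiso, .inl ⟨c1, c2, c4, d1, rfl⟩⟩
end

section
/- Let F be a finite field with |F| = q and char(F) = 3. Let N be the number of isomorphism classes among the algebras A9,3(β1) = (0, 1, 1, 1; β1, 0, 0, −1), where β1 ranges over those elements of F for which the polynomial (β1−t^3)(β1·t^2+β1·t+1)(β1^2·t^3+β1−2) has no root in F. Then the total number of isomorphism classes of two-dimensional algebras over F (including the algebra with zero multiplication) equals q^4+q^3+4q^2+4q+6+N. -/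
open Matrix MulAction

section Action

variable {K : Type*} [Field K]

/-- The matrix of `A ⊗ A` in the basis `e₁⊗e₁, e₁⊗e₂, e₂⊗e₁, e₂⊗e₂`. -/
def tensorSq (A : Matrix (Fin 2) (Fin 2) K) : Matrix (Fin 4) (Fin 4) K :=
  !![A 0 0 * A 0 0, A 0 0 * A 0 1, A 0 1 * A 0 0, A 0 1 * A 0 1;
     A 0 0 * A 1 0, A 0 0 * A 1 1, A 0 1 * A 1 0, A 0 1 * A 1 1;
     A 1 0 * A 0 0, A 1 0 * A 0 1, A 1 1 * A 0 0, A 1 1 * A 0 1;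
     A 1 0 * A 1 0, A 1 0 * A 1 1, A 1 1 * A 1 0, A 1 1 * A 1 1]

lemma tensorSq_one : tensorSq (1 : Matrix (Fin 2) (Fin 2) K) = 1 := by
  ext i j
  fin_cases i <;> fin_cases j <;> simp [tensorSq]

lemma tensorSq_mul (A B : Matrix (Fin 2) (Fin 2) K) :
    tensorSq (A * B) = tensorSq A * tensorSq B := by
  ext i j
  fin_cases i <;> fin_cases j <;>
    simp [tensorSq, Matrix.mul_apply, Fin.sum_univ_four, Fin.sum_univ_two] <;> ring

/-- Change of basis for matrices of structure constants. -/
instance structureConstantsAction : MulAction (GL (Fin 2) K) (Matrix (Fin 2) (Fin 4) K) where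
  smul g M := g.val * M * tensorSq (g⁻¹).val
  one_smul M := by
    change (1 : GL (Fin 2) K).val * M * tensorSq ((1 : GL (Fin 2) K)⁻¹).val = M
    simp [tensorSq_one]
  mul_smul g h M := by
    change (g * h).val * M * tensorSq ((g * h)⁻¹).val =
      g.val * (h.val * M * tensorSq (h⁻¹).val) * tensorSq (g⁻¹).val
    rw [_root_.mul_inv_rev, Units.val_mul, Units.val_mul, tensorSq_mul]
    simp only [Matrix.mul_assoc]

lemma smul_eq_iff (g : GL (Fin 2) K) (M N : Matrix (Fin 2) (Fin 4) K) :
    g • M = N ↔ g.val * M = N * tensorSq g.val := by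
  change g.val * M * tensorSq (g⁻¹).val = N ↔ _
  have h₁ : tensorSq (g⁻¹).val * tensorSq g.val = 1 := by
    rw [← tensorSq_mul, ← Units.val_mul, inv_mul_cancel, Units.val_one, tensorSq_one]
  have h₂ : tensorSq g.val * tensorSq (g⁻¹).val = 1 := by
    rw [← tensorSq_mul, ← Units.val_mul, mul_inv_cancel, Units.val_one, tensorSq_one]
  constructor
  · rintro rfl
    rw [Matrix.mul_assoc _ (tensorSq _), h₁, Matrix.mul_one]
  · intro h
    rw [h, Matrix.mul_assoc, h₂, Matrix.mul_one]

lemma scMul_eq_mulVec (M : Matrix (Fin 2) (Fin 4) K) (x y : Fin 2 → K) :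
    scMul K M x y = M *ᵥ ![x 0 * y 0, x 0 * y 1, x 1 * y 0, x 1 * y 1] := by
  ext i
  simp [scMul, Matrix.mulVec, dotProduct, Fin.sum_univ_four]
  ring

lemma tensorSq_mulVec (A : Matrix (Fin 2) (Fin 2) K) (x y : Fin 2 → K) :
    tensorSq A *ᵥ ![x 0 * y 0, x 0 * y 1, x 1 * y 0, x 1 * y 1] =
      ![(A *ᵥ x) 0 * (A *ᵥ y) 0, (A *ᵥ x) 0 * (A *ᵥ y) 1,
        (A *ᵥ x) 1 * (A *ᵥ y) 0, (A *ᵥ x) 1 * (A *ᵥ y) 1] := by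
  ext i
  fin_cases i <;>
    simp [tensorSq, Matrix.mulVec, dotProduct, Fin.sum_univ_four, Fin.sum_univ_two] <;> ring

lemma eq_of_mulVec_tensor_eq {M N : Matrix (Fin 2) (Fin 4) K}
    (h : ∀ x y : Fin 2 → K, M *ᵥ ![x 0 * y 0, x 0 * y 1, x 1 * y 0, x 1 * y 1] =
      N *ᵥ ![x 0 * y 0, x 0 * y 1, x 1 * y 0, x 1 * y 1]) : M = N := by
  ext i j
  have h₀ := congrFun (h ![1, 0] ![1, 0]) i
  have h₁ := congrFun (h ![1, 0] ![0, 1]) i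
  have h₂ := congrFun (h ![0, 1] ![1, 0]) i
  have h₃ := congrFun (h ![0, 1] ![0, 1]) i
  simp [Matrix.mulVec, dotProduct, Fin.sum_univ_four] at h₀ h₁ h₂ h₃
  fin_cases j <;> assumption

lemma scIso_iff (M N : Matrix (Fin 2) (Fin 4) K) :
    scIso K M N ↔ ∃ g : GL (Fin 2) K, g • M = N := by
  let e : GL (Fin 2) K ≃* ((Fin 2 → K) ≃ₗ[K] (Fin 2 → K)) :=
    Matrix.GeneralLinearGroup.toLin.trans
      (LinearMap.GeneralLinearGroup.generalLinearEquiv K (Fin 2 → K))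
  have he : ∀ g v, e.toEquiv g v = g.val *ᵥ v := fun _ _ => rfl
  unfold scIso
  rw [e.toEquiv.surjective.exists]
  refine exists_congr fun g => ?_
  rw [smul_eq_iff]
  simp only [he, scMul_eq_mulVec, ← tensorSq_mulVec, Matrix.mulVec_mulVec]
  exact ⟨eq_of_mulVec_tensor_eq, fun h x y => by rw [h]⟩

lemma card_quot_scIso :
    Nat.card (Quot (fun M N : Matrix (Fin 2) (Fin 4) K => scIso K M N)) =
      Nat.card (Quotient (orbitRel (GL (Fin 2) K) (Matrix (Fin 2) (Fin 4) K))) := by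
  refine Nat.card_congr (Quot.congr (Equiv.refl _) fun M N => ?_)
  rw [scIso_iff]
  change _ ↔ orbitRel _ _ M N
  rw [Setoid.comm', orbitRel_apply]
  rfl

lemma mem_fixedBy_iff (g : GL (Fin 2) K) (M : Matrix (Fin 2) (Fin 4) K) :
    M ∈ fixedBy (Matrix (Fin 2) (Fin 4) K) g ↔ g.val * M = M * tensorSq g.val :=
  smul_eq_iff g M M

lemma mem_fixedBy_upperTriangular_iff {g : GL (Fin 2) K} {a u b : K}
    (hg : g.val = !![a, u; 0, b]) (M : Matrix (Fin 2) (Fin 4) K) :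
    M ∈ fixedBy (Matrix (Fin 2) (Fin 4) K) g ↔
      (a * M 0 0 + u * M 1 0 = M 0 0 * (a * a) ∧
        a * M 0 1 + u * M 1 1 = M 0 0 * (a * u) + M 0 1 * (a * b) ∧
        a * M 0 2 + u * M 1 2 = M 0 0 * (u * a) + M 0 2 * (b * a) ∧
        a * M 0 3 + u * M 1 3 =
          M 0 0 * (u * u) + M 0 1 * (u * b) + M 0 2 * (b * u) + M 0 3 * (b * b)) ∧
      b * M 1 0 = M 1 0 * (a * a) ∧
        b * M 1 1 = M 1 0 * (a * u) + M 1 1 * (a * b) ∧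
        b * M 1 2 = M 1 0 * (u * a) + M 1 2 * (b * a) ∧
        b * M 1 3 =
          M 1 0 * (u * u) + M 1 1 * (u * b) + M 1 2 * (b * u) + M 1 3 * (b * b) := by
  rw [mem_fixedBy_iff, hg, ← Matrix.ext_iff]
  simp [Fin.forall_fin_succ, tensorSq, Matrix.mul_apply, Fin.sum_univ_four, Fin.sum_univ_two]

lemma card_fixedBy_eq_of_conj {g h P : GL (Fin 2) K} (hP : g.val * P.val = P.val * h.val) :
    Nat.card (fixedBy (Matrix (Fin 2) (Fin 4) K) g) =
      Nat.card (fixedBy (Matrix (Fin 2) (Fin 4) K) h) := by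
  have hg : g = P * h * P⁻¹ := eq_mul_inv_of_mul_eq (Units.ext hP)
  rw [hg, ← smul_fixedBy, Set.natCard_smul_set]

end Action

section NormalForms

variable {K : Type*} [Field K]

/-- A matrix with distinct eigenvalues in the base field is diagonalizable. -/
lemma exists_conj_diagonal {g : GL (Fin 2) K} {a b : K} (hab : a ≠ b)
    (ht : g.val.trace = a + b) (hd : g.val.det = a * b) :
    ∃ P h : GL (Fin 2) K, h.val = !![a, 0; 0, b] ∧ g.val * P.val = P.val * h.val := by
  have hab0 : a * b ≠ 0 := hd ▸ Matrix.GeneralLinearGroup.det_ne_zero g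
  let h : GL (Fin 2) K := .mkOfDetNeZero !![a, 0; 0, b] (by simpa [Matrix.det_fin_two] using hab0)
  suffices ∃ P : Matrix (Fin 2) (Fin 2) K, P.det ≠ 0 ∧ g.val * P = P * !![a, 0; 0, b] by
    obtain ⟨P, hP, hgP⟩ := this
    exact ⟨.mkOfDetNeZero P hP, h, rfl, hgP⟩
  rw [Matrix.eta_fin_two g.val] at ht hd ⊢
  generalize g.val 0 0 = x, g.val 0 1 = y, g.val 1 0 = z, g.val 1 1 = w at *
  simp [Matrix.det_fin_two, Matrix.trace_fin_two] at ht hd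
  have hsub : a - b ≠ 0 := sub_ne_zero.2 hab
  by_cases hz : z = 0
  · subst hz
    have hx : (x - a) * (x - b) = 0 := by linear_combination x * ht - hd
    rcases mul_eq_zero.1 hx with hx | hx
    · obtain rfl := sub_eq_zero.1 hx
      obtain rfl : w = b := by linear_combination ht
      refine ⟨!![1, y; 0, w - x], by simpa [Matrix.det_fin_two, sub_eq_zero, eq_comm] using hab, ?_⟩
      ext i j
      fin_cases i <;> fin_cases j <;> simp <;> ring
    · obtain rfl := sub_eq_zero.1 hx
      obtain rfl : w = a := by linear_combination ht
      refine ⟨!![y, 1; w - x, 0], by simpa [Matrix.det_fin_two, sub_eq_zero, eq_comm] using hab, ?_⟩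
      ext i j
      fin_cases i <;> fin_cases j <;> simp <;> ring
  · refine ⟨!![a - w, b - w; z, z], ?_, ?_⟩
    · have : (a - w) * z - (b - w) * z = (a - b) * z := by ring
      rw [Matrix.det_fin_two_of, this]
      exact mul_ne_zero hsub hz
    · obtain rfl : x = a + b - w := by linear_combination ht
      ext i j
      fin_cases i <;> fin_cases j <;> simp <;> first | ring1 | linear_combination -hd

lemma exists_conj_unipotent {g : GL (Fin 2) K} (hg : g ≠ 1)
    (ht : g.val.trace = 2) (hd : g.val.det = 1) :
    ∃ P h : GL (Fin 2) K, h.val = !![1, 1; 0, 1] ∧ g.val * P.val = P.val * h.val := by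
  let h : GL (Fin 2) K := .mkOfDetNeZero !![1, 1; 0, 1] (by simp [Matrix.det_fin_two])
  suffices ∃ P : Matrix (Fin 2) (Fin 2) K, P.det ≠ 0 ∧ g.val * P = P * !![1, 1; 0, 1] by
    obtain ⟨P, hP, hgP⟩ := this
    exact ⟨.mkOfDetNeZero P hP, h, rfl, hgP⟩
  replace hg : g.val ≠ 1 := fun h => hg (Units.ext h)
  rw [Matrix.eta_fin_two g.val] at ht hd hg ⊢
  generalize g.val 0 0 = x, g.val 0 1 = y, g.val 1 0 = z, g.val 1 1 = w at *
  simp [Matrix.det_fin_two, Matrix.trace_fin_two] at ht hd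
  obtain rfl : w = 2 - x := by linear_combination ht
  by_cases hz : z = 0
  · subst hz
    have hx : (x - 1) ^ 2 = 0 := by linear_combination -hd
    obtain rfl : x = 1 := sub_eq_zero.1 (pow_eq_zero_iff two_ne_zero |>.1 hx)
    have hy : y ≠ 0 := by
      rintro rfl
      refine hg ?_
      ext i j
      fin_cases i <;> fin_cases j <;> simp; norm_num
    refine ⟨!![y, 0; 0, 1], by simpa [Matrix.det_fin_two] using hy, ?_⟩
    ext i j
    fin_cases i <;> fin_cases j <;> simp; norm_num
  · refine ⟨!![x - 1, 1; z, 0], by simpa [Matrix.det_fin_two] using hz, ?_⟩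
    ext i j
    fin_cases i <;> fin_cases j <;> simp <;> first | ring1 | linear_combination -hd

lemma exists_conj_upperTriangular [IsAlgClosed K] (g : GL (Fin 2) K) :
    ∃ (P h : GL (Fin 2) K) (a u b : K),
      h.val = !![a, u; 0, b] ∧ g.val * P.val = P.val * h.val := by
  suffices ∃ (P : Matrix (Fin 2) (Fin 2) K) (a u b : K),
      P.det ≠ 0 ∧ g.val * P = P * !![a, u; 0, b] by
    obtain ⟨P, a, u, b, hP, hgP⟩ := this
    have hdet : (!![a, u; 0, b] : Matrix (Fin 2) (Fin 2) K).det ≠ 0 := by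
      intro h0
      have := congrArg Matrix.det hgP
      rw [Matrix.det_mul, Matrix.det_mul, h0, mul_zero] at this
      exact mul_ne_zero (Matrix.GeneralLinearGroup.det_ne_zero g) hP this
    exact ⟨.mkOfDetNeZero P hP, .mkOfDetNeZero _ hdet, a, u, b, rfl, hgP⟩
  rw [Matrix.eta_fin_two g.val]
  generalize g.val 0 0 = x, g.val 0 1 = y, g.val 1 0 = z, g.val 1 1 = w
  by_cases hz : z = 0
  · exact ⟨1, x, y, w, by simp, by simp [hz]⟩
  · obtain ⟨a, ha⟩ := IsAlgClosed.exists_root (!![x, y; z, w] : Matrix _ _ K).charpoly (by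
      rw [Matrix.charpoly_degree_eq_dim]; simp)
    rw [Polynomial.IsRoot.def, Matrix.charpoly_fin_two] at ha
    simp [Matrix.det_fin_two, Matrix.trace_fin_two] at ha
    refine ⟨!![a - w, 1; z, 0], a, 1, x + w - a, by simpa [Matrix.det_fin_two] using hz, ?_⟩
    ext i j
    fin_cases i <;> fin_cases j <;> simp <;> first | ring1 | linear_combination -ha

end NormalForms

section FixedPoints

variable {K : Type*} [Field K]

lemma card_fixedBy_upperTriangular_eq_one {g : GL (Fin 2) K} {a u b : K}
    (hg : g.val = !![a, u; 0, b]) (ha : a ≠ 1) (hb : b ≠ 1) (hab : a ≠ b ^ 2) (hba : b ≠ a ^ 2) :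
    Nat.card (fixedBy (Matrix (Fin 2) (Fin 4) K) g) = 1 := by
  have hdet : a * b ≠ 0 := by
    simpa [hg, Matrix.det_fin_two] using Matrix.GeneralLinearGroup.det_ne_zero g
  have ha0 := left_ne_zero_of_mul hdet
  have hb0 := right_ne_zero_of_mul hdet
  rw [← sub_ne_zero] at ha hb hab hba
  suffices fixedBy (Matrix (Fin 2) (Fin 4) K) g = {0} by rw [this, Nat.card_unique]
  ext M
  rw [mem_fixedBy_upperTriangular_iff hg, Set.mem_singleton_iff]
  constructor
  · rintro ⟨⟨h00, h01, h02, h03⟩, h10, h11, h12, h13⟩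
    have e10 : M 1 0 = 0 := (mul_eq_zero_iff_left hba).1 (by linear_combination h10)
    rw [e10] at h00 h11 h12 h13
    have e00 : M 0 0 = 0 :=
      (mul_eq_zero_iff_left (mul_ne_zero ha0 ha)).1 (by linear_combination -h00)
    have e11 : M 1 1 = 0 :=
      (mul_eq_zero_iff_left (mul_ne_zero hb0 ha)).1 (by linear_combination -h11)
    have e12 : M 1 2 = 0 :=
      (mul_eq_zero_iff_left (mul_ne_zero hb0 ha)).1 (by linear_combination -h12)
    rw [e11, e12] at h13
    rw [e00, e11] at h01
    rw [e00, e12] at h02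
    have e13 : M 1 3 = 0 :=
      (mul_eq_zero_iff_left (mul_ne_zero hb0 hb)).1 (by linear_combination -h13)
    have e01 : M 0 1 = 0 :=
      (mul_eq_zero_iff_left (mul_ne_zero ha0 hb)).1 (by linear_combination -h01)
    have e02 : M 0 2 = 0 :=
      (mul_eq_zero_iff_left (mul_ne_zero ha0 hb)).1 (by linear_combination -h02)
    rw [e13, e00, e01, e02] at h03
    have e03 : M 0 3 = 0 := (mul_eq_zero_iff_left hab).1 (by linear_combination h03)
    ext i j
    fin_cases i <;> fin_cases j <;> assumption
  · rintro rfl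
    simp

lemma card_fixedBy_eq_one_of_map {L : Type*} [Field L] (f : K →+* L) {g : GL (Fin 2) K}
    (h : Nat.card (fixedBy (Matrix (Fin 2) (Fin 4) L) (Matrix.GeneralLinearGroup.map f g)) = 1) :
    Nat.card (fixedBy (Matrix (Fin 2) (Fin 4) K) g) = 1 := by
  have hmem {M} (hM : M ∈ fixedBy (Matrix (Fin 2) (Fin 4) K) g) :
      M.map f ∈ fixedBy (Matrix (Fin 2) (Fin 4) L) (Matrix.GeneralLinearGroup.map f g) := by
    rw [mem_fixedBy_iff] at hM ⊢
    have hs : tensorSq (g.val.map f) = (tensorSq g.val).map f := by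
      ext i j
      fin_cases i <;> fin_cases j <;> simp [tensorSq]
    change g.val.map f * M.map f = M.map f * tensorSq (g.val.map f)
    rw [hs, ← Matrix.map_mul, ← Matrix.map_mul, hM]
  have hsub := (Nat.card_eq_one_iff_unique.1 h).1
  rw [Nat.card_eq_one_iff_unique]
  refine ⟨⟨fun M N => Subtype.ext (Matrix.map_injective f.injective ?_)⟩,
    ⟨⟨0, by rw [mem_fixedBy_iff]; simp⟩⟩⟩
  exact congrArg Subtype.val (hsub.elim ⟨_, hmem M.2⟩ ⟨_, hmem N.2⟩)

lemma card_fixedBy_eq_one [CharP K 3] {g : GL (Fin 2) K}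
    (h₁ : g.val.trace ≠ 1 + g.val.det) (h₂ : g.val.trace ^ 3 ≠ g.val.det + g.val.det ^ 2) :
    Nat.card (fixedBy (Matrix (Fin 2) (Fin 4) K) g) = 1 := by
  let f := algebraMap K (AlgebraicClosure K)
  refine card_fixedBy_eq_one_of_map f ?_
  obtain ⟨P, h, a, u, b, hh, hP⟩ := exists_conj_upperTriangular (Matrix.GeneralLinearGroup.map f g)
  rw [card_fixedBy_eq_of_conj hP]
  have h3 : (3 : AlgebraicClosure K) = 0 := by
    have : (3 : K) = 0 := by exact_mod_cast CharP.cast_eq_zero K 3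
    rw [← map_ofNat f 3, this, map_zero]
  have hconj : g.val.map f = P.val * h.val * (P⁻¹).val :=
    (Units.eq_mul_inv_iff_mul_eq P).2 hP
  have ht : f g.val.trace = a + b := by
    have : (g.val.map f).trace = f g.val.trace := by simp [Matrix.trace_fin_two]
    rw [← this, hconj, Matrix.trace_mul_comm, ← Matrix.mul_assoc, ← Units.val_mul,
      inv_mul_cancel, Units.val_one, Matrix.one_mul, hh]
    simp [Matrix.trace_fin_two]
  have hd : f g.val.det = a * b := by
    have : (g.val.map f).det = f g.val.det := by simp [Matrix.det_fin_two]
    rw [← this, hconj, Matrix.det_mul_comm, ← Matrix.mul_assoc, ← Units.val_mul,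
      inv_mul_cancel, Units.val_one, Matrix.one_mul, hh]
    simp [Matrix.det_fin_two]
  have h₁' : a + b ≠ 1 + a * b := by
    rw [← ht, ← hd, ← map_one f, ← map_add]
    exact f.injective.ne h₁
  have h₂' : (a + b) ^ 3 ≠ a * b + (a * b) ^ 2 := by
    rw [← ht, ← hd, ← map_pow, ← map_pow, ← map_add]
    exact f.injective.ne h₂
  apply card_fixedBy_upperTriangular_eq_one hh
  · rintro rfl
    exact h₁' (by ring)
  · rintro rfl
    exact h₁' (by ring)
  · rintro rfl
    exact h₂' (by linear_combination (b ^ 5 + b ^ 4) * h3)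
  · rintro rfl
    exact h₂' (by linear_combination (a ^ 5 + a ^ 4) * h3)

lemma card_eq_pow_of_parametrization {K : Type*} {n : ℕ} (S : Set (Matrix (Fin 2) (Fin 4) K))
    (f : (Fin n → K) → Matrix (Fin 2) (Fin 4) K) (r : Matrix (Fin 2) (Fin 4) K → Fin n → K)
    (hrf : ∀ v, r (f v) = v) (hS : ∀ M, M ∈ S ↔ f (r M) = M) :
    Nat.card S = Nat.card K ^ n := by
  have : S = Set.range f := by
    ext M
    rw [hS]
    exact ⟨fun h => ⟨_, h⟩, by rintro ⟨v, rfl⟩; rw [hrf]⟩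
  rw [this, Nat.card_range_of_injective (Function.LeftInverse.injective hrf), Nat.card_fun,
    Nat.card_fin]

lemma card_fixedBy_unipotent (h2 : (2 : K) ≠ 0) {g : GL (Fin 2) K}
    (hg : g.val = !![1, 1; 0, 1]) :
    Nat.card (fixedBy (Matrix (Fin 2) (Fin 4) K) g) = Nat.card K ^ 3 := by
  refine card_eq_pow_of_parametrization _
    (fun v => !![0, v 0, v 1, v 2; 0, 0, 0, v 0 + v 1]) (fun M => ![M 0 1, M 0 2, M 0 3])
    (fun v => by ext i; fin_cases i <;> rfl) fun M => ?_
  rw [mem_fixedBy_upperTriangular_iff hg, ← Matrix.ext_iff]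
  simp [Fin.forall_fin_succ]
  grind

lemma card_fixedBy_diagonal_one {g : GL (Fin 2) K} {b : K} (hg : g.val = !![1, 0; 0, b])
    (h1 : b ≠ 1) (h2 : b ≠ -1) :
    Nat.card (fixedBy (Matrix (Fin 2) (Fin 4) K) g) = Nat.card K ^ 3 := by
  have hb : b ≠ 0 := by
    simpa [hg, Matrix.det_fin_two] using Matrix.GeneralLinearGroup.det_ne_zero g
  refine card_eq_pow_of_parametrization _
    (fun v => !![v 0, 0, 0, 0; 0, v 1, v 2, 0]) (fun M => ![M 0 0, M 1 1, M 1 2])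
    (fun v => by ext i; fin_cases i <;> rfl) fun M => ?_
  rw [mem_fixedBy_upperTriangular_iff hg, ← Matrix.ext_iff]
  simp [Fin.forall_fin_succ]
  have hbb : b * b ≠ 1 := by simp [mul_self_eq_one_iff, h1, h2]
  grind

lemma card_fixedBy_diagonal_one_neg_one (h2 : (2 : K) ≠ 0) {g : GL (Fin 2) K}
    (hg : g.val = !![1, 0; 0, -1]) :
    Nat.card (fixedBy (Matrix (Fin 2) (Fin 4) K) g) = Nat.card K ^ 4 := by
  refine card_eq_pow_of_parametrization _
    (fun v => !![v 0, 0, 0, v 3; 0, v 1, v 2, 0]) (fun M => ![M 0 0, M 1 1, M 1 2, M 0 3])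
    (fun v => by ext i; fin_cases i <;> rfl) fun M => ?_
  rw [mem_fixedBy_upperTriangular_iff hg, ← Matrix.ext_iff]
  simp [Fin.forall_fin_succ]
  grind

lemma card_fixedBy_diagonal_sq {g : GL (Fin 2) K} {b : K} (hg : g.val = !![b ^ 2, 0; 0, b])
    (h1 : b ≠ 1) (h2 : b ≠ -1) (h3 : b ^ 3 ≠ 1) :
    Nat.card (fixedBy (Matrix (Fin 2) (Fin 4) K) g) = Nat.card K := by
  have hb : b ^ 2 * b ≠ 0 := by
    simpa [hg, Matrix.det_fin_two] using Matrix.GeneralLinearGroup.det_ne_zero g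
  rw [← pow_one (Nat.card K)]
  refine card_eq_pow_of_parametrization _
    (fun v => !![0, 0, 0, v 0; 0, 0, 0, 0]) (fun M => ![M 0 3])
    (fun v => by ext i; fin_cases i; rfl) fun M => ?_
  rw [mem_fixedBy_upperTriangular_iff hg, ← Matrix.ext_iff]
  simp [Fin.forall_fin_succ]
  have hbb : b * b ≠ 1 := by simp [mul_self_eq_one_iff, h1, h2]
  grind

end FixedPoints

section Counting

variable {F : Type*} [Field F] [Fintype F] [DecidableEq F]

lemma card_filter_mul_eq (k : F) :
    ((Finset.univ.filter fun p : F × F => p.1 * p.2 = k).card : ℤ) =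
      (Fintype.card F - 1) + if k = 0 then (Fintype.card F : ℤ) else 0 := by
  have hfib (y : F) : ((Finset.univ.filter fun z : F => y * z = k).card : ℤ) =
      if y = 0 then (if k = 0 then (Fintype.card F : ℤ) else 0) else 1 := by
    split_ifs with hy hk
    · simp [hy, hk]
    · simp [hy, Ne.symm hk]
    · have : (Finset.univ.filter fun z : F => y * z = k) = {y⁻¹ * k} := by
        ext z
        simp [eq_inv_mul_iff_mul_eq₀ hy]
      simp [this]
  rw [Finset.card_filter, Fintype.sum_prod_type]
  simp_rw [← Finset.card_filter]
  push_cast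
  simp_rw [hfib]
  rw [← Finset.add_sum_erase _ _ (Finset.mem_univ (0 : F)),
    Finset.sum_congr rfl fun y hy => if_neg (Finset.ne_of_mem_erase hy)]
  simp [Finset.card_erase_of_mem, Nat.cast_sub Fintype.card_pos]
  ring

lemma card_matrix_trace_det (a b : F) :
    ((Finset.univ.filter fun A : Matrix (Fin 2) (Fin 2) F =>
      A.trace = a + b ∧ A.det = a * b).card : ℤ) =
      Fintype.card F * (Fintype.card F - 1) +
        Fintype.card F * ({a, b} : Finset F).card := by
  let S (x : F) := Finset.univ.filter fun p : F × F => p.1 * p.2 = -((x - a) * (x - b))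
  have hcard : (Finset.univ.filter fun A : Matrix (Fin 2) (Fin 2) F =>
      A.trace = a + b ∧ A.det = a * b).card = (Finset.univ.sigma S).card := by
    refine Finset.card_nbij' (fun A => ⟨A 0 0, A 0 1, A 1 0⟩)
      (fun t => !![t.1, t.2.1; t.2.2, a + b - t.1]) ?_ ?_ ?_ ?_
    · intro A hA
      simp [Matrix.trace_fin_two, Matrix.det_fin_two, S] at hA ⊢
      linear_combination A 0 0 * hA.1 - hA.2
    · intro t ht
      simp [Matrix.trace_fin_two, Matrix.det_fin_two, S] at ht ⊢
      linear_combination -ht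
    · intro A hA
      simp [Matrix.trace_fin_two] at hA
      have : a + b - A 0 0 = A 1 1 := by linear_combination -hA.1
      ext i j
      fin_cases i <;> fin_cases j <;> simp [this]
    · rintro ⟨x, y, z⟩ -
      simp
  rw [hcard, Finset.card_sigma]
  push_cast
  simp only [S, card_filter_mul_eq]
  have hroots : (Finset.univ.filter fun x : F => -((x - a) * (x - b)) = 0) = {a, b} := by
    ext x
    simp [sub_eq_zero]
  rw [Finset.sum_add_distrib, ← Finset.sum_filter, hroots]
  simp
  ring

lemma card_GL_trace_det {a b : F} (hab : a * b ≠ 0) :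
    ((Finset.univ.filter fun g : GL (Fin 2) F =>
      g.val.trace = a + b ∧ g.val.det = a * b).card : ℤ) =
      Fintype.card F * (Fintype.card F - 1) +
        Fintype.card F * ({a, b} : Finset F).card := by
  rw [← card_matrix_trace_det]
  congr 1
  refine Finset.card_bij (fun g _ => g.val) (by simp) (fun _ _ _ _ h => Units.ext h) ?_
  intro A hA
  simp only [Finset.mem_filter, Finset.mem_univ, true_and] at hA
  exact ⟨.mkOfDetNeZero A (hA.2 ▸ hab), by simpa using hA, rfl⟩

lemma card_GL_trace_det_of_ne {a b : F} (hab : a * b ≠ 0) (h : a ≠ b) :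
    ((Finset.univ.filter fun g : GL (Fin 2) F =>
      g.val.trace = a + b ∧ g.val.det = a * b).card : ℤ) =
      Fintype.card F ^ 2 + Fintype.card F := by
  rw [card_GL_trace_det hab, Finset.card_pair h]
  push_cast
  ring

/-- The number of invertible matrices with eigenvalue `1`. -/
lemma card_GL_eigenvalue_one :
    ((Finset.univ.filter fun g : GL (Fin 2) F => g.val.trace = 1 + g.val.det).card : ℤ) =
      Fintype.card F ^ 2 +
        (Fintype.card F - 2) * (Fintype.card F ^ 2 + Fintype.card F) := by
  have hfib (d : F) : ({g ∈ Finset.univ.filter fun g : GL (Fin 2) F =>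
      g.val.trace = 1 + g.val.det | g.val.det = d}) =
      Finset.univ.filter fun g : GL (Fin 2) F => g.val.trace = 1 + d ∧ g.val.det = 1 * d := by
    ext g
    simp +contextual [and_congr_left_iff]
  rw [Finset.card_eq_sum_card_fiberwise (f := fun g : GL (Fin 2) F => g.val.det)
    (t := Finset.univ.erase 0) (fun g _ => by
      simpa using Matrix.GeneralLinearGroup.det_ne_zero g)]
  simp only [hfib]
  rw [← Finset.add_sum_erase _ _ (show (1 : F) ∈ Finset.univ.erase 0 by simp)]
  push_cast
  rw [card_GL_trace_det (by simp), Finset.sum_congr rfl fun d hd => card_GL_trace_det_of_ne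
    (by simp at hd; simp [hd]) (by simp at hd; exact Ne.symm hd.1)]
  have hq : 2 ≤ Fintype.card F := Fintype.one_lt_card
  simp [Finset.card_erase_of_mem]
  rw [Nat.sub_sub, Nat.cast_sub hq]
  push_cast
  ring

/-- The number of invertible matrices with eigenvalues `c, c²` where `c ≠ ±1`. -/
lemma card_GL_eigenvalue_sq [CharP F 3] :
    ((Finset.univ.filter fun g : GL (Fin 2) F =>
      g.val.trace ^ 3 = g.val.det + g.val.det ^ 2 ∧ g.val.det ≠ 1 ∧ g.val.det ≠ -1).card : ℤ) =
      (Fintype.card F - 3) * (Fintype.card F ^ 2 + Fintype.card F) := by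
  have : Fact (Nat.Prime 3) := ⟨Nat.prime_three⟩
  let e : F ≃ F := Equiv.ofBijective (frobenius F 3)
    (Finite.injective_iff_bijective.1 (frobenius F 3).injective)
  have he (x) : e x = x ^ 3 := rfl
  have h2 : (2 : F) ≠ 0 := by
    intro h
    have h3 : (3 : F) = 0 := by exact_mod_cast CharP.cast_eq_zero F 3
    exact one_ne_zero (α := F) (by linear_combination h3 - h)
  have h11 : (-1 : F) ≠ 1 := by
    intro h
    exact h2 (by linear_combination -h)
  have he1 (c : F) : c ^ 3 = 1 ↔ c = 1 := by
    rw [← he, ← e.apply_eq_iff_eq (x := c), he 1, one_pow]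
  have he2 (c : F) : c ^ 3 = -1 ↔ c = -1 := by
    rw [← he, ← e.apply_eq_iff_eq (x := c), he (-1)]
    norm_num
  have hfib (c : F) (hc : c ∈ ((Finset.univ.erase 0).erase 1).erase (-1 : F)) :
      ({g ∈ Finset.univ.filter fun g : GL (Fin 2) F =>
        g.val.trace ^ 3 = g.val.det + g.val.det ^ 2 ∧ g.val.det ≠ 1 ∧ g.val.det ≠ -1 |
          e.symm g.val.det = c}) =
      Finset.univ.filter fun g : GL (Fin 2) F =>
        g.val.trace = c ^ 2 + c ∧ g.val.det = c ^ 2 * c := by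
    simp only [Finset.mem_erase, Finset.mem_univ, and_true] at hc
    ext g
    simp only [Finset.mem_filter, Finset.mem_univ, true_and, Equiv.symm_apply_eq, he]
    have hc3 : c ^ 2 * c = c ^ 3 := by ring
    rw [hc3]
    refine ⟨fun h => ⟨e.injective ?_, h.2⟩, fun h => ⟨⟨?_, ?_, ?_⟩, h.2⟩⟩
    · rw [he, h.1.1, h.2, he, add_pow_char]
      ring
    · rw [h.1, h.2, add_pow_char]
      ring
    · rw [h.2, Ne, he1]
      exact hc.2.1
    · rw [h.2, Ne, he2]
      exact hc.1
  rw [Finset.card_eq_sum_card_fiberwise (f := fun g : GL (Fin 2) F => e.symm g.val.det)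
    (t := ((Finset.univ.erase 0).erase 1).erase (-1 : F)) (fun g hg => by
      simp only [Finset.coe_filter, Set.mem_ofPred_eq, Finset.mem_univ, true_and] at hg
      simp only [Finset.coe_erase, Finset.coe_univ, Set.mem_sdiff, Set.mem_singleton_iff,
        Set.mem_univ, true_and, Equiv.symm_apply_eq, he]
      refine ⟨⟨?_, ?_⟩, ?_⟩
      · simpa using Matrix.GeneralLinearGroup.det_ne_zero g
      · simpa using hg.2.1
      · have : (-1 : F) ^ 3 = -1 := by norm_num
        rw [this]
        exact hg.2.2)]
  push_cast
  rw [Finset.sum_congr rfl fun c hc => by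
    rw [hfib c hc, card_GL_trace_det_of_ne (by simp at hc; simp [hc])
      (by
        simp at hc
        rw [Ne, sq, mul_eq_right₀ hc.2.2]
        exact hc.2.1)]]
  have hq : 3 ≤ Fintype.card F := by
    have : ({0, 1, -1} : Finset F).card ≤ Fintype.card F := Finset.card_le_univ _
    rwa [Finset.card_eq_three.2 ⟨0, 1, -1, by simp, by simp, h11.symm, rfl⟩] at this
  have : (((Finset.univ.erase 0).erase 1).erase (-1 : F)).card = Fintype.card F - 3 := by
    rw [Finset.card_erase_of_mem (by simp [h11]), Finset.card_erase_of_mem (by simp),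
      Finset.card_erase_of_mem (by simp), Finset.card_univ]
    omega
  rw [Finset.sum_const, this, nsmul_eq_mul, Nat.cast_sub hq]
  push_cast
  ring

end Counting

section Main

variable {F : Type*} [Field F]

lemma cube_surjective [Finite F] [CharP F 3] (x : F) : ∃ c, c ^ 3 = x := by
  have : Fact (Nat.Prime 3) := ⟨Nat.prime_three⟩
  exact Finite.surjective_of_injective (frobenius F 3).injective x

lemma card_fixedBy_eq [Fintype F] [DecidableEq F] [CharP F 3] (g : GL (Fin 2) F) :
    (Nat.card (fixedBy (Matrix (Fin 2) (Fin 4) F) g) : ℤ) =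
      1 + (if g = 1 then (Fintype.card F : ℤ) ^ 8 - Fintype.card F ^ 3 else 0) +
        (if g.val.trace = 1 + g.val.det then (Fintype.card F : ℤ) ^ 3 - 1 else 0) +
        (if g.val.trace = 1 + -1 ∧ g.val.det = 1 * -1 then
          (Fintype.card F : ℤ) ^ 4 - Fintype.card F ^ 3 else 0) +
        (if g.val.trace ^ 3 = g.val.det + g.val.det ^ 2 ∧ g.val.det ≠ 1 ∧ g.val.det ≠ -1 then
          (Fintype.card F : ℤ) - 1 else 0) := by
  have h3 : (3 : F) = 0 := by exact_mod_cast CharP.cast_eq_zero F 3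
  have h2 : (2 : F) ≠ 0 := by
    intro h
    exact one_ne_zero (α := F) (by linear_combination h3 - h)
  have h11 : (1 : F) ≠ -1 := by
    intro h
    exact h2 (by linear_combination h)
  by_cases hg : g = 1
  · subst hg
    have : fixedBy (Matrix (Fin 2) (Fin 4) F) (1 : GL (Fin 2) F) = Set.univ := by
      ext M
      simp
    rw [this, Nat.card_congr (Equiv.Set.univ _)]
    simp [h11, Nat.card_eq_fintype_card, Matrix, ← pow_mul, one_add_one_eq_two, h2]
    ring
  rw [if_neg hg]
  by_cases ht : g.val.trace = 1 + g.val.det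
  · rw [if_pos ht, if_neg (c := _ ∧ _ ∧ _)]
    · by_cases hd : g.val.det = 1
      · obtain ⟨P, h, hh, hP⟩ := exists_conj_unipotent hg (by rw [ht, hd]; norm_num) hd
        rw [card_fixedBy_eq_of_conj hP, card_fixedBy_unipotent h2 hh]
        simp [hd, h11]
      · obtain ⟨P, h, hh, hP⟩ := exists_conj_diagonal (Ne.symm hd) ht (one_mul _).symm
        rw [card_fixedBy_eq_of_conj hP]
        by_cases hd' : g.val.det = -1
        · rw [hd'] at hh
          rw [card_fixedBy_diagonal_one_neg_one h2 hh]
          simp [ht, hd']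
        · rw [card_fixedBy_diagonal_one hh hd hd']
          simp [hd']
    · rintro ⟨h, h1, h1'⟩
      rw [ht] at h
      have : (g.val.det - 1) * ((g.val.det - 1) * (g.val.det + 1)) = 0 := by
        linear_combination h - h3 * (g.val.det + g.val.det ^ 2)
      simp [sub_eq_zero, h1, add_eq_zero_iff_eq_neg, h1'] at this
  · rw [if_neg ht, if_neg (c := _ ∧ _) (fun h => ht (by rw [h.1, h.2, one_mul]))]
    obtain ⟨c, hc⟩ := cube_surjective g.val.det
    by_cases hs : g.val.trace ^ 3 = g.val.det + g.val.det ^ 2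
    · have hs' : g.val.trace = c ^ 2 + c := by
        have : Fact (Nat.Prime 3) := ⟨Nat.prime_three⟩
        apply (frobenius F 3).injective
        rw [frobenius_def, frobenius_def, hs, ← hc, add_pow_char]
        ring
      have hc1 : c ≠ 1 := by
        rintro rfl
        exact ht (by rw [hs', ← hc]; norm_num)
      have hc1' : c ≠ -1 := by
        rintro rfl
        exact ht (by rw [hs', ← hc]; norm_num)
      have hc0 : c ≠ 0 := by
        rintro rfl
        exact Matrix.GeneralLinearGroup.det_ne_zero g (by rw [← hc]; norm_num)
      have hd1 : g.val.det ≠ 1 := by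
        rw [← hc]
        intro h
        have : (c - 1) ^ 3 = 0 := by linear_combination h - h3 * (c ^ 2 - c)
        exact hc1 (sub_eq_zero.1 (pow_eq_zero_iff three_ne_zero |>.1 this))
      have hd1' : g.val.det ≠ -1 := by
        rw [← hc]
        intro h
        have : (c + 1) ^ 3 = 0 := by linear_combination h + h3 * (c ^ 2 + c)
        exact hc1' (eq_neg_of_add_eq_zero_left (pow_eq_zero_iff three_ne_zero |>.1 this))
      have hne : c ^ 2 ≠ c := by rwa [Ne, sq, mul_eq_right₀ hc0]
      obtain ⟨P, h, hh, hP⟩ := exists_conj_diagonal hne hs' (by rw [← hc]; ring)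
      rw [card_fixedBy_eq_of_conj hP, card_fixedBy_diagonal_sq hh hc1 hc1' (hc ▸ hd1),
        if_pos ⟨hs, hd1, hd1'⟩]
      simp
    · rw [if_neg fun h => hs h.1, card_fixedBy_eq_one ht hs]
      simp

lemma card_orbits [Fintype F] [CharP F 3] :
    Nat.card (Quotient (orbitRel (GL (Fin 2) F) (Matrix (Fin 2) (Fin 4) F))) =
      Fintype.card F ^ 4 + Fintype.card F ^ 3 + 4 * Fintype.card F ^ 2 + 4 * Fintype.card F + 6 := by
  classical
  have hburnside := sum_card_fixedBy_eq_card_orbits_mul_card_group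
    (GL (Fin 2) F) (Matrix (Fin 2) (Fin 4) F)
  have hq : 1 < Fintype.card F := Fintype.one_lt_card
  have hGL : (Fintype.card (GL (Fin 2) F) : ℤ) =
      (Fintype.card F ^ 2 - 1) * (Fintype.card F ^ 2 - Fintype.card F) := by
    rw [← Nat.card_eq_fintype_card, Matrix.card_GL_field]
    simp only [Fin.prod_univ_two, Fin.val_zero, Fin.val_one, pow_zero, pow_one]
    rw [Nat.cast_mul, Nat.cast_sub (Nat.one_le_pow _ _ (by omega)),
      Nat.cast_sub (Nat.le_self_pow two_ne_zero _)]
    push_cast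
    ring
  have hpos : (Fintype.card (GL (Fin 2) F) : ℤ) ≠ 0 := by
    exact_mod_cast Fintype.card_ne_zero
  simp only [← Nat.card_eq_fintype_card (α := fixedBy _ _),
    ← Nat.card_eq_fintype_card (α := Quotient _)] at hburnside
  zify at hburnside ⊢
  apply mul_right_cancel₀ hpos
  rw [← hburnside]
  simp only [card_fixedBy_eq, Finset.sum_add_distrib]
  simp only [← Finset.sum_filter, Finset.sum_const, nsmul_eq_mul]
  rw [card_GL_eigenvalue_one, card_GL_eigenvalue_sq,
    card_GL_trace_det_of_ne (a := (1 : F)) (b := -1) (by simp), Finset.card_univ, hGL,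
    Finset.filter_eq' , if_pos (Finset.mem_univ _), Finset.card_singleton]
  · push_cast
    ring
  · intro h
    have h3 : (3 : F) = 0 := by exact_mod_cast CharP.cast_eq_zero F 3
    exact one_ne_zero (α := F) (by linear_combination h3 - h)

end Main

/-- The number of isomorphism classes of two-dimensional algebras over a finite
field of characteristic 3. -/
theorem count_two_dim_algebras_char_three (F : Type*) [Field F] [Fintype F]
    (h3 : ringChar F = 3)
    (q : ℕ) (hq : q = Fintype.card F)
    (N : ℕ)
    (hN : N = Nat.card (Quot (fun b b' :
        {b : F // ∀ t : F, (b - t ^ 3) * (b * t ^ 2 + b * t + 1) *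
          (b ^ 2 * t ^ 3 + b - 2) ≠ 0} =>
        scIso F !![0, 1, 1, 1; b.1, 0, 0, -1] !![0, 1, 1, 1; b'.1, 0, 0, -1]))) :
    Nat.card (Quot (fun M M' : Matrix (Fin 2) (Fin 4) F => scIso F M M')) =
      q ^ 4 + q ^ 3 + 4 * q ^ 2 + 4 * q + 6 + N := by
  have : CharP F 3 := ringChar.of_eq h3
  have hempty : IsEmpty {b : F // ∀ t : F, (b - t ^ 3) * (b * t ^ 2 + b * t + 1) *
      (b ^ 2 * t ^ 3 + b - 2) ≠ 0} := by
    refine ⟨fun b => ?_⟩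
    obtain ⟨t, ht⟩ := cube_surjective b.1
    exact b.2 t (by simp [ht])
  have hN0 : N = 0 := by
    rw [hN, Nat.card_eq_zero]
    exact .inl ⟨fun x => x.exists_rep.elim fun b _ => hempty.elim b⟩
  rw [card_quot_scIso, card_orbits, hq, hN0, add_zero]
end

section
/- Let F be a finite field with |F| = q and char(F) = 2. The number of isomorphism classes among the algebras A4,2(α1,β1,β2) = (α1, 1, 1, 0; β1, β2, 1+α1, 1), for (α1,β1,β2) ∈ F^3, equals 2q^2 − q. -/
/-- The matrix of structure constants of the algebra `A₄,₂(α₁,β₁,β₂)`. -/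
def A42mat (F : Type*) [Field F] (c : F × F × F) : Matrix (Fin 2) (Fin 4) F :=
  !![c.1, 1, 1, 0; c.2.1, c.2.2, 1 + c.1, 1]

/-- The additive map `a ↦ a² + (1 + b) a` of a field of characteristic 2. -/
def sqAddMul (F : Type*) [Field F] [CharP F 2] (b : F) : F →+ F where
  toFun a := a ^ 2 + (1 + b) * a
  map_zero' := by ring
  map_add' x y := by rw [CharTwo.add_sq]; ring

theorem mem_ker_sqAddMul {F : Type*} [Field F] [CharP F 2] (b a : F) :
    a ∈ (sqAddMul F b).ker ↔ a = 0 ∨ a = 1 + b := by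
  have h : sqAddMul F b a = a * (a - (1 + b)) := by
    rw [CharTwo.sub_eq_add]
    simp only [sqAddMul, AddMonoidHom.coe_mk, ZeroHom.coe_mk]
    ring
  rw [AddMonoidHom.mem_ker, h, mul_eq_zero, sub_eq_zero]

theorem index_range_sqAddMul {F : Type*} [Field F] [Finite F] [DecidableEq F] [CharP F 2] (b : F) :
    (sqAddMul F b).range.index = if b = 1 then 1 else 2 := by
  rw [AddSubgroup.index_range]
  have hker : ((sqAddMul F b).ker : Set F) = {0, 1 + b} := by
    ext a
    exact mem_ker_sqAddMul b a
  rw [← SetLike.coe_sort_coe, hker, Nat.card_coe_set_eq]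
  split_ifs with hb
  · simp [hb, CharTwo.add_self_eq_zero]
  · refine Set.ncard_pair fun h => hb ?_
    rw [← sub_eq_zero, CharTwo.sub_eq_add, add_comm, ← h]

/-- The shear `e₁ ↦ e₁ + a e₂`, `e₂ ↦ e₂`. -/
def shear (F : Type*) [Field F] (a : F) : (Fin 2 → F) ≃ₗ[F] (Fin 2 → F) where
  toFun x := ![x 0, a * x 0 + x 1]
  invFun x := ![x 0, x 1 - a * x 0]
  map_add' x y := by ext i; fin_cases i <;> simp; ring
  map_smul' c x := by ext i; fin_cases i <;> simp; ring
  left_inv x := by ext i; fin_cases i <;> simp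
  right_inv x := by ext i; fin_cases i <;> simp

theorem scIso_A42mat_iff {F : Type*} [Field F] [CharP F 2] (c c' : F × F × F) :
    scIso F (A42mat F c) (A42mat F c') ↔
      c.1 = c'.1 ∧ c.2.2 = c'.2.2 ∧ -c.2.1 + c'.2.1 ∈ (sqAddMul F c.2.2).range := by
  obtain ⟨α, β, b⟩ := c
  obtain ⟨α', β', b'⟩ := c'
  have two : (2 : F) = 0 := CharTwo.two_eq_zero
  constructor
  · rintro ⟨g, hg⟩
    have e11 := hg ![1, 0] ![1, 0]
    have e12 := hg ![1, 0] ![0, 1]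
    have e21 := hg ![0, 1] ![1, 0]
    have e22 := hg ![0, 1] ![0, 1]
    have expand (x : Fin 2 → F) : g x = x 0 • g ![1, 0] + x 1 • g ![0, 1] := by
      rw [← map_smul, ← map_smul, ← map_add]
      congr 1
      ext i
      fin_cases i <;> simp
    have inj (x : Fin 2 → F) (hx : x 0 • g ![1, 0] + x 1 • g ![0, 1] = 0) : x = 0 :=
      g.map_eq_zero_iff.1 ((expand x).trans hx)
    rw [expand (scMul _ _ _ _)] at e11 e12 e21 e22
    generalize g ![1, 0] = u at *
    generalize g ![0, 1] = v at *
    have det_ne : u 0 * v 1 - u 1 * v 0 ≠ 0 := by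
      intro hdet
      have h0 := inj ![v 0, -u 0] (by
        ext i
        fin_cases i
        · simp; ring
        · simp; linear_combination -hdet)
      have h1 := inj ![v 1, -u 1] (by
        ext i
        fin_cases i
        · simp; linear_combination hdet
        · simp; ring)
      have hu : u = 0 := by
        ext i
        fin_cases i
        · simpa using congrFun h0 1
        · simpa using congrFun h1 1
      have h := congrFun (inj ![1, 0] (by simp [hu])) 0
      simp at h
    have e110 := congrFun e11 0
    have e111 := congrFun e11 1
    have e120 := congrFun e12 0
    have e121 := congrFun e12 1
    have e210 := congrFun e21 0
    have e211 := congrFun e21 1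
    have e220 := congrFun e22 0
    have e221 := congrFun e22 1
    clear e11 e12 e21 e22 expand inj
    simp [scMul, A42mat] at e110 e111 e120 e121 e210 e211 e220 e221
    generalize u 0 = p at *
    generalize u 1 = r at *
    generalize v 0 = s at *
    generalize v 1 = t at *
    -- `g` preserves the trace of right multiplication, which is the first coordinate.
    have hp : p = 1 := by
      apply mul_left_cancel₀ det_ne
      grind
    have hs : s = 0 := by
      apply mul_left_cancel₀ det_ne
      grind
    subst hp hs
    have ht : t = 1 := by grind
    subst ht
    refine ⟨by grind, by grind, r, ?_⟩
    simp only [sqAddMul, AddMonoidHom.coe_mk, ZeroHom.coe_mk]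
    grind
  · rintro ⟨rfl, rfl, a, ha⟩
    refine ⟨shear F a, fun x y => ?_⟩
    simp only [sqAddMul, AddMonoidHom.coe_mk, ZeroHom.coe_mk] at ha
    obtain rfl : β' = β + (a ^ 2 + (1 + b) * a) := by
      linear_combination -ha
    ext i
    fin_cases i
    · simp [shear, scMul, A42mat]
      linear_combination (-(x 0 * y 0 * a)) * two
    · simp [shear, scMul, A42mat]
      grind

/-- The isomorphism classes of the family, fibred over the invariants `α₁` and `β₂`. -/
noncomputable def quotScIsoEquiv (F : Type*) [Field F] [CharP F 2] :
    Quot (fun c c' : F × F × F => scIso F (A42mat F c) (A42mat F c')) ≃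
      F × Σ b : F, F ⧸ (sqAddMul F b).range :=
  Equiv.ofBijective
    (Quot.lift (fun c => (c.1, ⟨c.2.2, QuotientAddGroup.mk c.2.1⟩)) fun c c' h => by
      obtain ⟨α, β, b⟩ := c
      obtain ⟨α', β', b'⟩ := c'
      obtain ⟨h1, h2, h3⟩ := (scIso_A42mat_iff _ _).1 h
      dsimp only at h1 h2 h3 ⊢
      subst h1 h2
      rw [QuotientAddGroup.eq.2 h3])
    ⟨by
      rintro ⟨α, β, b⟩ ⟨α', β', b'⟩ h
      simp only [Prod.mk.injEq, Sigma.mk.injEq] at h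
      obtain ⟨rfl, rfl, h⟩ := h
      exact Quot.sound ((scIso_A42mat_iff _ _).2 ⟨rfl, rfl, QuotientAddGroup.eq.1 (eq_of_heq h)⟩),
    by
      rintro ⟨α, b, x⟩
      induction x using QuotientAddGroup.induction_on with
      | H β => exact ⟨Quot.mk _ (α, β, b), rfl⟩⟩

/-- Over a finite field of characteristic 2, the number of isomorphism classes in
the family `A₄,₂` is `2q² - q`. -/
theorem count_A42_family (F : Type*) [Field F] [Fintype F]
    (h2 : ringChar F = 2)
    (q : ℕ) (hq : q = Fintype.card F) :
    Nat.card (Quot (fun c c' : F × F × F => scIso F (A42mat F c) (A42mat F c'))) =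
      2 * q ^ 2 - q := by
  classical
  have : CharP F 2 := ringChar.of_eq h2
  rw [Nat.card_congr (quotScIsoEquiv F), Nat.card_prod, Nat.card_sigma]
  have hsum : ∑ b : F, Nat.card (F ⧸ (sqAddMul F b).range) = 2 * q - 1 := by
    have hq0 : 0 < q := hq ▸ Fintype.card_pos
    simp_rw [← AddSubgroup.index_eq_card, index_range_sqAddMul]
    rw [← Finset.add_sum_erase _ _ (Finset.mem_univ (1 : F)), if_pos rfl,
      Finset.sum_congr rfl fun b hb => if_neg (Finset.ne_of_mem_erase hb), Finset.sum_const,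
      Finset.card_erase_of_mem (Finset.mem_univ _), Finset.card_univ, ← hq, smul_eq_mul]
    omega
  rw [hsum, Nat.card_eq_fintype_card, ← hq, Nat.mul_sub]
  congr 1 <;> ring
end

section
/- Let F be a field with char(F) ∉ {2,3}, let β1 ∈ F, and let a ∈ F satisfy 2a+1 ≠ 0 and (β1·a^3−3a−1)(β1·a^2+β1·a+1)(β1^2·a^3+6β1·a^2+3β1·a+β1−2) ≠ 0. Then the algebra A10(β1) with matrix of structure constants (0, 1, 1, 1; β1, 0, 0, −1) is isomorphic to the algebra A10(β1') with matrix of structure constants (0, 1, 1, 1; β1', 0, 0, −1), where β1' = (β1^2·a^3+6β1·a^2+3β1·a+β1−2)^2 / (β1·a^2+β1·a+1)^3. -/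
/-- A matrix with nonzero determinant that respects products of vectors gives an isomorphism. -/
theorem scIso_of_matrix {F : Type*} [Field F] {M N : Matrix (Fin 2) (Fin 4) F}
    (G : Matrix (Fin 2) (Fin 2) F) (hG : G.det ≠ 0)
    (h : ∀ x y, G.mulVec (scMul F M x y) = scMul F N (G.mulVec x) (G.mulVec y)) :
    scIso F M N :=
  ⟨LinearEquiv.ofInjectiveEndo (Matrix.toLin' G)
    (Matrix.mulVec_injective_iff_isUnit.2 ((Matrix.isUnit_iff_isUnit_det G).2 hG.isUnit)),
    h⟩

/-- `A₁₀(β₁) ≃ A₁₀(β₁'(a))` over a field of characteristic ≠ 2, 3, where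
`β₁'(a) = (β₁²a³+6β₁a²+3β₁a+β₁-2)² / (β₁a²+β₁a+1)³`. -/
theorem A10_iso_param_change (F : Type*) [Field F]
    (h2 : ringChar F ≠ 2) (h3 : ringChar F ≠ 3) (b a : F)
    (ha : 2 * a + 1 ≠ 0)
    (hpoly : (b * a ^ 3 - 3 * a - 1) * (b * a ^ 2 + b * a + 1) *
      (b ^ 2 * a ^ 3 + 6 * b * a ^ 2 + 3 * b * a + b - 2) ≠ 0) :
    scIso F !![0, 1, 1, 1; b, 0, 0, -1]
      !![0, 1, 1, 1;
         (b ^ 2 * a ^ 3 + 6 * b * a ^ 2 + 3 * b * a + b - 2) ^ 2 /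
           (b * a ^ 2 + b * a + 1) ^ 3, 0, 0, -1] := by
  obtain ⟨hCH, hR⟩ := mul_ne_zero_iff.1 hpoly
  obtain ⟨hC, hH⟩ := mul_ne_zero_iff.1 hCH
  set C := b * a ^ 3 - 3 * a - 1 with hCdef
  set H := b * a ^ 2 + b * a + 1 with hHdef
  set R := b ^ 2 * a ^ 3 + 6 * b * a ^ 2 + 3 * b * a + b - 2 with hRdef
  let A := 1 + 2 * a
  let B := 2 * a + b * a ^ 2
  let s := -H / (C * R)
  let G : Matrix (Fin 2) (Fin 2) F :=
    !![s * (H * (A - B)), s * (H * A);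
      s * (A ^ 2 * (b - 1) - B ^ 2 + 2 * A * B - H * (A - B)), s * (A ^ 2 - B ^ 2 - H * A)]
  have hdet : G.det = H ^ 3 / (C * R) := by
    simp only [G, s, A, B, Matrix.det_fin_two_of]
    field_simp
    rw [hCdef, hHdef, hRdef]
    ring
  refine scIso_of_matrix G (hdet ▸ div_ne_zero (pow_ne_zero _ hH) (mul_ne_zero hC hR)) ?_
  intro x y
  ext i
  fin_cases i
  · simp [G, s, scMul, Matrix.mulVec, dotProduct, Fin.sum_univ_two]
    field_simp
    simp only [A, B, hCdef, hHdef, hRdef]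
    ring
  · simp [G, s, scMul, Matrix.mulVec, dotProduct, Fin.sum_univ_two]
    field_simp
    simp only [A, B, hCdef, hHdef, hRdef]
    ring
end

section
/- Let F be a field with char(F) = 2, let β1 ∈ F, and let a, b ∈ F with b ≠ 0. Then the algebra A11,2(β1) with matrix of structure constants (0, 1, 1, 0; β1, 0, 0, 1) is isomorphic to the algebra A11,2(b^2·(β1+a^2)) with matrix of structure constants (0, 1, 1, 0; b^2·(β1+a^2), 0, 0, 1). -/
/-- `A₁₁,₂(β₁) ≃ A₁₁,₂(b²(β₁+a²))` over a field of characteristic 2, for `b ≠ 0`. -/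
theorem A112_iso_param_change (F : Type*) [Field F]
    (h2 : ringChar F = 2) (β1 a b : F) (hb : b ≠ 0) :
    scIso F !![0, 1, 1, 0; β1, 0, 0, 1]
      !![0, 1, 1, 0; b ^ 2 * (β1 + a ^ 2), 0, 0, 1] := by
  have : CharP F 2 := ringChar.of_eq h2
  have two_eq : (2 : F) = 0 := CharTwo.two_eq_zero
  -- The isomorphism sends `e₁` to `b⁻¹ e₁ + a e₂` and fixes `e₂`.
  let g : (Fin 2 → F) ≃ₗ[F] (Fin 2 → F) :=
    { toFun := fun x => ![b⁻¹ * x 0, a * x 0 + x 1]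
      invFun := fun y => ![b * y 0, y 1 - a * (b * y 0)]
      map_add' := fun x y => by
        ext i; fin_cases i <;> simp <;> ring
      map_smul' := fun c x => by
        ext i; fin_cases i <;> simp <;> ring
      left_inv := fun x => by
        ext i; fin_cases i <;> simp [hb]
      right_inv := fun y => by
        ext i; fin_cases i <;> simp [hb] }
  refine ⟨g, fun x y => ?_⟩
  ext i
  fin_cases i
  · simp only [g, scMul, LinearEquiv.coe_mk, LinearMap.coe_mk, AddHom.coe_mk]
    simp
    linear_combination (-(b⁻¹ * a * x 0 * y 0)) * two_eq
  · simp only [g, scMul, LinearEquiv.coe_mk, LinearMap.coe_mk, AddHom.coe_mk]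
    simp
    field_simp
    linear_combination (-(a ^ 2 * x 0 * y 0)) * two_eq
end
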